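/- arXiv:2506.20035 — 4 statements merged into one kernel-verified Lean document; each statement's English description precedes it below -/
import Mathlib

section
/- Let f be a bounded measurable probability density on ℝ. Then the following are equivalent: (i) there exists a probability measure Π on ℝ such that f(t) = ∫_ℝ φ(t−h) dΠ(h) for Lebesgue-almost every t ∈ ℝ; (ii) for every ε > 0 there exists π ∈ F_∞ with ‖f − φ∗π‖_Y < ε (i.e., inf_{π ∈ F_∞} ‖f − φ∗π‖_Y = 0). -/
open MeasureTheory Real

/-- Density of the normal distribution `N(0, s2)` with variance `s2`. -/
noncomputable def gauss (s2 t : ℝ) : ℝ :=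
  (Real.sqrt (2 * Real.pi * s2))⁻¹ * Real.exp (-t ^ 2 / (2 * s2))

/-- `F_∞`: bounded measurable probability densities on `ℝ`. -/
def IsBoundedDensity (g : ℝ → ℝ) : Prop :=
  Measurable g ∧ (∀ x, 0 ≤ g x) ∧ (∫ x, g x) = 1 ∧
    ∃ C : ℝ, ∀ᵐ x ∂(volume : Measure ℝ), g x ≤ C

/-- The weighted norm `‖g‖_Y = (∫ g(t)² φ_{σ²}(t) dt)^{1/2}`. -/
noncomputable def ynorm (σ : ℝ) (g : ℝ → ℝ) : ℝ :=
  Real.sqrt (∫ t, g t ^ 2 * gauss (σ ^ 2) t)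

open Filter Topology ProbabilityTheory
open scoped NNReal ENNReal

lemma gauss_eq_gaussianPDFReal (v : ℝ≥0) (t : ℝ) : gauss v t = gaussianPDFReal 0 v t := by
  simp [gauss, gaussianPDFReal]

lemma continuous_gauss (v : ℝ) : Continuous (gauss v) := by
  unfold gauss
  fun_prop

lemma gauss_nonneg (v t : ℝ) : 0 ≤ gauss v t := by
  unfold gauss
  positivity

lemma gauss_le {v : ℝ} (hv : 0 ≤ v) (t : ℝ) : gauss v t ≤ (√(2 * π * v))⁻¹ := by
  refine mul_le_of_le_one_right (by positivity) (Real.exp_le_one_iff.2 ?_)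
  rw [neg_div, neg_nonpos]
  positivity

lemma gaussianReal_eq_withDensity_gauss {v : ℝ≥0} (hv : v ≠ 0) :
    gaussianReal 0 v = volume.withDensity fun t ↦ ENNReal.ofReal (gauss v t) := by
  rw [gaussianReal_of_var_ne_zero 0 hv]
  simp only [gauss_eq_gaussianPDFReal]
  rfl

lemma integral_mul_gauss {v : ℝ≥0} (hv : v ≠ 0) (g : ℝ → ℝ) :
    ∫ t, g t * gauss v t = ∫ t, g t ∂(gaussianReal 0 v) := by
  simp only [integral_gaussianReal_eq_integral_smul hv, gauss_eq_gaussianPDFReal, smul_eq_mul,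
    mul_comm]

/-- The Gaussian location mixture with mixing measure `P` and component variance `v`. -/
noncomputable def gaussMix (v : ℝ) (P : Measure ℝ) (t : ℝ) : ℝ :=
  ∫ h, gauss v (t - h) ∂P

lemma integrable_gauss_sub {v : ℝ} (hv : 0 ≤ v) (P : Measure ℝ) [IsFiniteMeasure P] (t : ℝ) :
    Integrable (fun h ↦ gauss v (t - h)) P := by
  refine .of_bound (C := (√(2 * π * v))⁻¹)
    ((continuous_gauss v).comp (continuous_const.sub continuous_id)).aestronglyMeasurable
    (.of_forall fun h ↦ ?_)
  rw [Real.norm_of_nonneg (gauss_nonneg _ _)]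
  exact gauss_le hv _

lemma gaussMix_nonneg (v : ℝ) (P : Measure ℝ) (t : ℝ) : 0 ≤ gaussMix v P t :=
  integral_nonneg fun _ ↦ gauss_nonneg _ _

lemma gaussMix_le {v : ℝ} (hv : 0 ≤ v) (P : Measure ℝ) [IsProbabilityMeasure P] (t : ℝ) :
    gaussMix v P t ≤ (√(2 * π * v))⁻¹ := by
  refine (integral_mono (integrable_gauss_sub hv P t) (integrable_const _)
    fun h ↦ gauss_le hv (t - h)).trans ?_
  simp

lemma measurable_gaussMix (v : ℝ) (P : Measure ℝ) [SFinite P] : Measurable (gaussMix v P) := by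
  have h : Continuous fun x : ℝ × ℝ ↦ gauss v (x.1 - x.2) :=
    (continuous_gauss v).comp (continuous_fst.sub continuous_snd)
  exact h.stronglyMeasurable.integral_prod_right.measurable

lemma conv_gaussianReal_eq_withDensity (P : Measure ℝ) [IsProbabilityMeasure P] {v : ℝ≥0}
    (hv : v ≠ 0) :
    P ∗ gaussianReal 0 v = volume.withDensity fun t ↦ ENNReal.ofReal (gaussMix v P t) := by
  have hm : Measurable fun t ↦ ENNReal.ofReal (gauss v t) :=
    (continuous_gauss v).measurable.ennreal_ofReal
  ext s hs
  have hind : Measurable (s.indicator (1 : ℝ → ℝ≥0∞)) := measurable_one.indicator hs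
  have hmm : Measurable fun x : ℝ × ℝ ↦
      ENNReal.ofReal (gauss v (x.2 - x.1)) * s.indicator 1 x.2 :=
    (hm.comp (measurable_snd.sub measurable_fst)).mul (hind.comp measurable_snd)
  calc (P ∗ gaussianReal 0 v) s
      = ∫⁻ h, ∫⁻ y, s.indicator 1 (h + y) ∂(gaussianReal 0 v) ∂P := by
        rw [← Measure.lintegral_conv hind, lintegral_indicator_one hs]
    _ = ∫⁻ h, (∫⁻ t, ENNReal.ofReal (gauss v (t - h)) * s.indicator 1 t) ∂P := by
        refine lintegral_congr fun h ↦ ?_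
        have hh : Measurable fun y ↦ s.indicator (1 : ℝ → ℝ≥0∞) (h + y) :=
          hind.comp (measurable_const_add h)
        rw [gaussianReal_eq_withDensity_gauss hv, lintegral_withDensity_eq_lintegral_mul _ hm hh,
          ← lintegral_sub_right_eq_self _ h]
        simp
    _ = ∫⁻ t, ENNReal.ofReal (gaussMix v P t) * s.indicator 1 t := by
        rw [lintegral_lintegral_swap hmm.aemeasurable]
        refine lintegral_congr fun t ↦ ?_
        have ht : Measurable fun x ↦ ENNReal.ofReal (gauss v (t - x)) :=
          hm.comp (measurable_const_sub t)
        rw [lintegral_mul_const _ ht, gaussMix,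
          ofReal_integral_eq_lintegral_ofReal (integrable_gauss_sub v.coe_nonneg P t)
            (.of_forall fun _ ↦ gauss_nonneg _ _)]
    _ = (volume.withDensity fun t ↦ ENNReal.ofReal (gaussMix v P t)) s := by
        rw [withDensity_apply _ hs, ← lintegral_indicator hs]
        refine lintegral_congr fun t ↦ ?_
        by_cases ht : t ∈ s <;> simp [ht]

lemma integral_eq_one_of_isProbabilityMeasure_withDensity {g : ℝ → ℝ} (hg : Measurable g)
    (hg0 : ∀ x, 0 ≤ g x)
    [h : IsProbabilityMeasure (volume.withDensity fun x ↦ ENNReal.ofReal (g x))] :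
    ∫ x, g x = 1 := by
  rw [integral_eq_lintegral_of_nonneg_ae (.of_forall hg0) hg.aestronglyMeasurable,
    ← setLIntegral_univ, ← withDensity_apply _ .univ, measure_univ, ENNReal.toReal_one]

lemma isBoundedDensity_gaussMix (P : Measure ℝ) [IsProbabilityMeasure P] {v : ℝ≥0} (hv : v ≠ 0) :
    IsBoundedDensity (gaussMix v P) := by
  have : IsProbabilityMeasure (volume.withDensity fun t ↦ ENNReal.ofReal (gaussMix v P t)) :=
    conv_gaussianReal_eq_withDensity P hv ▸ inferInstance
  exact ⟨measurable_gaussMix v P, gaussMix_nonneg v P,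
    integral_eq_one_of_isProbabilityMeasure_withDensity (measurable_gaussMix v P)
      (gaussMix_nonneg v P), _, .of_forall (gaussMix_le v.coe_nonneg P)⟩

namespace IsBoundedDensity

variable {p : ℝ → ℝ}

lemma integrable (hp : IsBoundedDensity p) : Integrable p :=
  .of_integral_ne_zero (by simp [hp.2.2.1])

lemma isProbabilityMeasure (hp : IsBoundedDensity p) :
    IsProbabilityMeasure (volume.withDensity fun x ↦ ENNReal.ofReal (p x)) := by
  refine ⟨?_⟩
  rw [withDensity_apply _ .univ, setLIntegral_univ,
    ← ofReal_integral_eq_lintegral_ofReal hp.integrable (.of_forall hp.2.1), hp.2.2.1,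
    ENNReal.ofReal_one]

lemma integral_gauss_mul (hp : IsBoundedDensity p) (v t : ℝ) :
    ∫ h, gauss v (t - h) * p h
      = gaussMix v (volume.withDensity fun x ↦ ENNReal.ofReal (p x)) t := by
  rw [gaussMix, integral_withDensity_eq_integral_toReal_smul hp.1.ennreal_ofReal
    (.of_forall fun _ ↦ ENNReal.ofReal_lt_top)]
  simp [ENNReal.toReal_ofReal (hp.2.1 _), mul_comm]

end IsBoundedDensity

lemma ae_eq_of_withDensity_ofReal_eq {g₁ g₂ : ℝ → ℝ} (h₁ : Measurable g₁) (h₂ : Measurable g₂)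
    (hg₁ : ∀ x, 0 ≤ g₁ x) (hg₂ : ∀ x, 0 ≤ g₂ x)
    (h : volume.withDensity (fun x ↦ ENNReal.ofReal (g₁ x))
      = volume.withDensity fun x ↦ ENNReal.ofReal (g₂ x)) :
    g₁ =ᵐ[volume] g₂ := by
  filter_upwards [(withDensity_eq_iff_of_sigmaFinite h₁.ennreal_ofReal.aemeasurable
    h₂.ennreal_ofReal.aemeasurable).1 h] with x hx
  exact (ENNReal.ofReal_eq_ofReal_iff (hg₁ x) (hg₂ x)).1 hx

lemma gaussMix_gaussMix_ae_eq (P : Measure ℝ) [IsProbabilityMeasure P] {v w : ℝ≥0} (hv : v ≠ 0)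
    (hw : w ≠ 0) :
    (fun t ↦ ∫ h, gauss w (t - h) * gaussMix v P h) =ᵐ[volume] gaussMix ↑(v + w) P := by
  have hd := isBoundedDensity_gaussMix P hv
  simp only [hd.integral_gauss_mul]
  refine ae_eq_of_withDensity_ofReal_eq (measurable_gaussMix _ _) (measurable_gaussMix _ _)
    (gaussMix_nonneg _ _) (gaussMix_nonneg _ _) ?_
  have := hd.isProbabilityMeasure
  rw [← conv_gaussianReal_eq_withDensity _ hw, ← conv_gaussianReal_eq_withDensity P hv,
    ← conv_gaussianReal_eq_withDensity P (by simp [hv]), Measure.conv_assoc,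
    gaussianReal_conv_gaussianReal, add_zero]

lemma abs_gauss_one_sub_gauss_le {d : ℝ} (hd : 0 ≤ d) (u : ℝ) :
    |gauss 1 u - gauss (d + 1) u| ≤ 2 * d := by
  set x := u ^ 2 / (2 * (d + 1)) with hx
  have hx0 : 0 ≤ x := by positivity
  have hs : 1 ≤ √(d + 1) := Real.one_le_sqrt.2 (by linarith)
  have hs2 : √(d + 1) ^ 2 = d + 1 := Real.sq_sqrt (by linarith)
  have hsd : √(d + 1) ≤ d + 1 := by nlinarith
  have hc : (√(2 * π))⁻¹ ≤ 1 :=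
    inv_le_one_of_one_le₀ (Real.one_le_sqrt.2 (by linarith [Real.pi_gt_three]))
  have hc0 : 0 ≤ (√(2 * π))⁻¹ := by positivity
  have h1 : gauss 1 u = (√(2 * π))⁻¹ * (rexp (-x) * rexp (-(d * x))) := by
    rw [gauss, ← Real.exp_add, mul_one]
    congr 2
    rw [hx]
    field_simp
    ring
  have h2 : gauss (d + 1) u = (√(2 * π))⁻¹ * ((√(d + 1))⁻¹ * rexp (-x)) := by
    rw [gauss, Real.sqrt_mul (by positivity), mul_inv, mul_assoc, hx, neg_div]
  have he1 : rexp (-x) ≤ 1 := Real.exp_le_one_iff.2 (by linarith)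
  have he0 := Real.exp_pos (-x)
  have hxe : x * rexp (-x) ≤ 1 := by
    rw [Real.exp_neg, ← div_eq_mul_inv, div_le_one (Real.exp_pos x)]
    linarith [Real.add_one_le_exp x]
  have hf1 : rexp (-(d * x)) ≤ 1 := Real.exp_le_one_iff.2 (by nlinarith)
  have hf2 : 1 - d * x ≤ rexp (-(d * x)) := by linarith [Real.add_one_le_exp (-(d * x))]
  have hi1 : (√(d + 1))⁻¹ ≤ 1 := inv_le_one_of_one_le₀ hs
  have hi2 : 1 - d ≤ (√(d + 1))⁻¹ := by
    rw [← one_div, le_div_iff₀ (by linarith)]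
    nlinarith
  have key : |rexp (-x) * rexp (-(d * x)) - (√(d + 1))⁻¹ * rexp (-x)| ≤ 2 * d := by
    rw [abs_le]
    constructor
    · nlinarith [mul_le_mul_of_nonneg_left hf2 he0.le, mul_le_mul_of_nonneg_left hxe hd,
        mul_le_mul_of_nonneg_right hi1 he0.le]
    · nlinarith [mul_le_mul_of_nonneg_left hf1 he0.le, mul_le_mul_of_nonneg_right hi2 he0.le]
  rw [h1, h2, ← mul_sub, abs_mul, abs_of_nonneg hc0]
  exact (mul_le_of_le_one_left (abs_nonneg _) hc).trans key

lemma abs_gaussMix_one_sub_gaussMix_le (P : Measure ℝ) [IsProbabilityMeasure P] {d : ℝ}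
    (hd : 0 ≤ d) (t : ℝ) :
    |gaussMix 1 P t - gaussMix (d + 1) P t| ≤ 2 * d := by
  rw [gaussMix, gaussMix, ← integral_sub (integrable_gauss_sub zero_le_one P t)
    (integrable_gauss_sub (by linarith) P t)]
  have h : ∀ᵐ h ∂P, ‖gauss 1 (t - h) - gauss (d + 1) (t - h)‖ ≤ 2 * d :=
    .of_forall fun h ↦ abs_gauss_one_sub_gauss_le hd (t - h)
  simpa using norm_integral_le_of_norm_le_const h

lemma ynorm_le {σ : ℝ} (hσ : 0 < σ) {g : ℝ → ℝ} {C : ℝ} (hC : 0 ≤ C)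
    (hg : ∀ᵐ t, |g t| ≤ C) : ynorm σ g ≤ C := by
  let v : ℝ≥0 := ⟨σ ^ 2, sq_nonneg σ⟩
  have hv : v ≠ 0 := NNReal.coe_ne_zero.1 (pow_pos hσ 2).ne'
  refine Real.sqrt_le_iff.2 ⟨hC, ?_⟩
  refine (integral_mul_gauss hv fun t ↦ g t ^ 2).le.trans ?_
  refine (le_abs_self _).trans ?_
  have hg' : ∀ᵐ t ∂(gaussianReal 0 v), ‖g t ^ 2‖ ≤ C ^ 2 := by
    filter_upwards [(gaussianReal_absolutelyContinuous 0 hv).ae_le hg] with t ht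
    rw [norm_pow]
    gcongr
    exact ht
  simpa using norm_integral_le_of_norm_le_const hg'

/-- **Lévy continuity theorem**: a pointwise limit of characteristic functions which is
continuous at `0` is the characteristic function of a probability measure. -/
lemma exists_charFun_eq_of_tendsto_charFun {μ : ℕ → Measure ℝ} [∀ n, IsProbabilityMeasure (μ n)]
    {ψ : ℝ → ℂ} (hψ : ContinuousAt ψ 0)
    (h : ∀ t, Tendsto (fun n ↦ charFun (μ n) t) atTop (𝓝 (ψ t))) :
    ∃ Q : Measure ℝ, IsProbabilityMeasure Q ∧ charFun Q = ψ := by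
  let ν : ℕ → ProbabilityMeasure ℝ := fun n ↦ ⟨μ n, inferInstance⟩
  have htight : IsTightMeasureSet
      {((ρ : ProbabilityMeasure ℝ) : Measure ℝ) | ρ ∈ Set.range ν} := by
    convert! isTightMeasureSet_of_tendsto_charFun hψ h
    ext ρ
    exact Set.exists_range_iff
  obtain ⟨Q, -, k, hk, hQ⟩ := (isCompact_closure_of_isTightMeasureSet htight).tendsto_subseq
    fun n ↦ subset_closure (Set.mem_range_self n)
  refine ⟨Q, inferInstance, funext fun t ↦ ?_⟩
  exact tendsto_nhds_unique (ProbabilityMeasure.tendsto_iff_tendsto_charFun.1 hQ t)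
    ((h t).comp hk.tendsto_atTop)

/-- **Scheffé lemma**, in weak form. -/
lemma tendsto_of_ae_tendsto_density {μ : ProbabilityMeasure ℝ} {ν : ℕ → ProbabilityMeasure ℝ}
    {g : ℝ → ℝ} {q : ℕ → ℝ → ℝ} (hq : ∀ n, Measurable (q n))
    (hμ : (μ : Measure ℝ) = volume.withDensity fun x ↦ ENNReal.ofReal (g x))
    (hν : ∀ n, (ν n : Measure ℝ) = volume.withDensity fun x ↦ ENNReal.ofReal (q n x))
    (h : ∀ᵐ x, Tendsto (fun n ↦ q n x) atTop (𝓝 (g x))) :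
    Tendsto ν atTop (𝓝 μ) := by
  refine tendsto_of_forall_isOpen_le_liminf_nat' fun G hG ↦ ?_
  simp only [hμ, hν, withDensity_apply _ hG.measurableSet]
  refine (lintegral_congr_ae ?_).trans_le
    (lintegral_liminf_le fun n ↦ (hq n).ennreal_ofReal)
  filter_upwards [ae_restrict_of_ae h] with x hx
  exact ((ENNReal.continuous_ofReal.tendsto _).comp hx).liminf_eq.symm

lemma exists_subseq_ae_tendsto_of_ynorm_lt {σ : ℝ} (hσ : 0 < σ) {g : ℕ → ℝ → ℝ} {C : ℝ}
    (hgm : ∀ n, Measurable (g n)) (hgC : ∀ n, ∀ᵐ t, |g n t| ≤ C)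
    (hg : ∀ n : ℕ, ynorm σ (g n) < 1 / ((n : ℝ) + 1)) :
    ∃ k : ℕ → ℕ, StrictMono k ∧ ∀ᵐ t, Tendsto (fun n ↦ g (k n) t) atTop (𝓝 0) := by
  let v : ℝ≥0 := ⟨σ ^ 2, sq_nonneg σ⟩
  have hv : v ≠ 0 := NNReal.coe_ne_zero.1 (pow_pos hσ 2).ne'
  have hint n : Integrable (fun t ↦ g n t ^ 2) (gaussianReal 0 v) := by
    refine .of_bound (C := C ^ 2) ((hgm n).pow_const 2).aestronglyMeasurable ?_
    filter_upwards [(gaussianReal_absolutelyContinuous 0 hv).ae_le (hgC n)] with t ht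
    rw [norm_pow]
    gcongr
    exact ht
  have hy n : ynorm σ (g n) = √(∫ t, g n t ^ 2 ∂(gaussianReal 0 v)) :=
    congrArg Real.sqrt (integral_mul_gauss hv fun t ↦ g n t ^ 2)
  have hlim : Tendsto (fun n ↦ ∫ t, g n t ^ 2 ∂(gaussianReal 0 v)) atTop (𝓝 0) := by
    have h0 : Tendsto (fun n ↦ ynorm σ (g n)) atTop (𝓝 0) :=
      squeeze_zero (fun n ↦ Real.sqrt_nonneg _) (fun n ↦ (hg n).le)
        tendsto_one_div_add_atTop_nhds_zero_nat
    have h1 := h0.pow 2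
    simp only [hy, Real.sq_sqrt (integral_nonneg fun t ↦ sq_nonneg (g _ t))] at h1
    simpa using h1
  have hL1 : Tendsto (fun n ↦ eLpNorm ((fun t ↦ g n t ^ 2) - 0) 1 (gaussianReal 0 v)) atTop
      (𝓝 0) := by
    have h0 := ENNReal.tendsto_ofReal hlim
    rw [ENNReal.ofReal_zero] at h0
    refine h0.congr fun n ↦ ?_
    rw [sub_zero, eLpNorm_one_eq_lintegral_enorm,
      ← ofReal_integral_norm_eq_lintegral_enorm (hint n)]
    simp
  obtain ⟨k, hk, hae⟩ := (tendstoInMeasure_of_tendsto_eLpNorm one_ne_zero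
    (fun n ↦ (hint n).1) aestronglyMeasurable_zero hL1).exists_seq_tendsto_ae
  refine ⟨k, hk, ?_⟩
  filter_upwards [(gaussianReal_absolutelyContinuous' 0 hv).ae_le hae] with t ht
  simpa [Real.sqrt_sq_eq_abs, tendsto_zero_iff_abs_tendsto_zero, Function.comp_def] using ht.sqrt

lemma exists_ae_eq_gaussMix_of_ae_tendsto {f : ℝ → ℝ} (hf : IsBoundedDensity f)
    {μ : ℕ → Measure ℝ} [∀ n, IsProbabilityMeasure (μ n)]
    (h : ∀ᵐ t, Tendsto (fun n ↦ gaussMix 1 (μ n) t) atTop (𝓝 (f t))) :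
    ∃ Q : Measure ℝ, IsProbabilityMeasure Q ∧ f =ᵐ[volume] gaussMix 1 Q := by
  have hfP := hf.isProbabilityMeasure
  have hden (Q : Measure ℝ) [IsProbabilityMeasure Q] : Q ∗ gaussianReal 0 1
      = volume.withDensity fun x ↦ ENNReal.ofReal (gaussMix 1 Q x) := by
    simpa using conv_gaussianReal_eq_withDensity Q one_ne_zero
  let μf : ProbabilityMeasure ℝ := ⟨_, hfP⟩
  let ν : ℕ → ProbabilityMeasure ℝ := fun n ↦ ⟨μ n ∗ gaussianReal 0 1, inferInstance⟩
  have hw : Tendsto ν atTop (𝓝 μf) :=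
    tendsto_of_ae_tendsto_density (fun n ↦ measurable_gaussMix 1 (μ n)) rfl
      (fun n ↦ hden (μ n)) h
  have hG (t : ℝ) : charFun (gaussianReal 0 1) t ≠ 0 := by
    rw [charFun_gaussianReal]
    exact Complex.exp_ne_zero _
  obtain ⟨Q, hQ, hQψ⟩ := exists_charFun_eq_of_tendsto_charFun (μ := μ)
    (ψ := fun t ↦ charFun (μf : Measure ℝ) t / charFun (gaussianReal 0 1) t)
    (continuous_charFun.div continuous_charFun hG).continuousAt fun t ↦ by
      have h1 := (ProbabilityMeasure.tendsto_iff_tendsto_charFun.1 hw t).div_const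
        (charFun (gaussianReal 0 1) t)
      refine h1.congr fun n ↦ ?_
      simp [ν, charFun_conv, hG t]
  refine ⟨Q, hQ, ?_⟩
  refine ae_eq_of_withDensity_ofReal_eq hf.1 (measurable_gaussMix 1 Q) hf.2.1
    (gaussMix_nonneg 1 Q) ?_
  rw [← hden Q]
  refine Measure.ext_of_charFun (funext fun t ↦ ?_)
  rw [charFun_conv, hQψ, div_mul_cancel₀ _ (hG t)]
  rfl

/-- A bounded probability density `f` is a Gaussian location mixture (for some
mixing probability measure) iff it is at `‖·‖_Y`-distance zero from the set of
Gaussian convolutions of bounded densities. -/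
theorem mixture_iff_zero_distance (σ : ℝ) (hσ : 0 < σ) (f : ℝ → ℝ)
    (hf : IsBoundedDensity f) :
    (∃ P : Measure ℝ, IsProbabilityMeasure P ∧
        ∀ᵐ t ∂(volume : Measure ℝ), f t = ∫ h, gauss 1 (t - h) ∂P) ↔
      (∀ ε > 0, ∃ p : ℝ → ℝ, IsBoundedDensity p ∧
        ynorm σ (fun t => f t - ∫ h, gauss 1 (t - h) * p h) < ε) := by
  constructor
  · rintro ⟨P, hP, hfP⟩ ε hε
    let d : ℝ≥0 := ⟨ε / 4, by positivity⟩
    have hd : d ≠ 0 := NNReal.coe_ne_zero.1 (div_pos hε four_pos).ne'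
    refine ⟨gaussMix d P, isBoundedDensity_gaussMix P hd, ?_⟩
    refine (ynorm_le hσ (C := 2 * d) (by positivity) ?_).trans_lt
      (show 2 * (ε / 4) < ε by linarith)
    filter_upwards [hfP, gaussMix_gaussMix_ae_eq P hd one_ne_zero] with t h1 h2
    rw [NNReal.coe_one] at h2
    rw [h1, h2, NNReal.coe_add, NNReal.coe_one]
    exact abs_gaussMix_one_sub_gaussMix_le P d.2 t
  · intro h
    choose p hp hlt using fun n : ℕ ↦ h (1 / ((n : ℝ) + 1)) Nat.one_div_pos_of_nat
    let μ : ℕ → Measure ℝ := fun n ↦ volume.withDensity fun x ↦ ENNReal.ofReal (p n x)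
    have hμ n : IsProbabilityMeasure (μ n) := (hp n).isProbabilityMeasure
    simp only [(hp _).integral_gauss_mul] at hlt
    obtain ⟨C, hC⟩ := hf.2.2.2
    obtain ⟨k, -, hk⟩ := exists_subseq_ae_tendsto_of_ynorm_lt hσ
      (g := fun n t ↦ f t - gaussMix 1 (μ n) t) (C := max C (√(2 * π * 1))⁻¹)
      (fun n ↦ hf.1.sub (measurable_gaussMix 1 (μ n)))
      (fun n ↦ by
        filter_upwards [hC] with t ht
        have h1 := gaussMix_nonneg 1 (μ n) t
        have h2 := gaussMix_le zero_le_one (μ n) t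
        have h3 := hf.2.1 t
        rw [abs_le]
        constructor <;> linarith [le_max_left C (√(2 * π * 1))⁻¹,
          le_max_right C (√(2 * π * 1))⁻¹]) hlt
    refine exists_ae_eq_gaussMix_of_ae_tendsto hf (μ := fun n ↦ μ (k n)) ?_
    filter_upwards [hk] with t ht
    simpa using ht.const_sub (f t)
end

section
/- For every j ∈ ℕ and every x ∈ ℝ, the Gaussian–Hermite integral identity ∫_ℝ ψ_j(t) φ(t−x) φ_{σ²}(t) dt = η_j χ_j(x) φ_{1+σ²}(x) holds; that is, the j-th weighted Hermite coefficient of the shifted Gaussian kernel t ↦ φ(t−x) with respect to the weight φ_{σ²} equals η_j χ_j(x) φ_{1+σ²}(x). -/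
open MeasureTheory Real

/-- The `j`-th probabilist's Hermite polynomial. -/
noncomputable def He (j : ℕ) (t : ℝ) : ℝ :=
  ∑ l ∈ Finset.range (j / 2 + 1),
    (-1 : ℝ) ^ l * ((Nat.factorial (2 * l) : ℝ) / ((2 : ℝ) ^ l * (Nat.factorial l : ℝ))) *
      (Nat.choose j (2 * l) : ℝ) * t ^ (j - 2 * l)

/-- `ψ_j(t) = He_j(t/σ)/√(j!)`. -/
noncomputable def ψ (σ : ℝ) (j : ℕ) (t : ℝ) : ℝ :=
  He j (t / σ) / Real.sqrt (Nat.factorial j)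

/-- `χ_j(x) = He_j(x/√(1+σ²))/√(j!)`. -/
noncomputable def χ (σ : ℝ) (j : ℕ) (x : ℝ) : ℝ :=
  He j (x / Real.sqrt (1 + σ ^ 2)) / Real.sqrt (Nat.factorial j)

/-- `η_j = (σ²/(1+σ²))^{j/2}`. -/
noncomputable def η (σ : ℝ) (j : ℕ) : ℝ :=
  Real.sqrt (σ ^ 2 / (1 + σ ^ 2)) ^ j

open Polynomial in
/-- Derivative rule `He_n' = n He_{n-1}` for the Hermite polynomials. -/
theorem derivative_hermite (n : ℕ) :
    derivative (hermite n) = (n : ℤ[X]) * hermite (n - 1) := by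
  induction n with
  | zero => simp
  | succ n ih =>
    rcases n with _ | n
    · simp
    · simp only [Nat.add_sub_cancel] at ih ⊢
      rw [hermite_succ (n + 1)]
      simp only [derivative_sub, derivative_mul, derivative_X, ih, derivative_natCast]
      rw [hermite_succ n]
      push_cast
      ring

open Polynomial in
/-- Three-term recurrence for the Hermite polynomials. -/
theorem hermite_succ_eq (n : ℕ) :
    hermite (n + 1) = X * hermite n - (n : ℤ[X]) * hermite (n - 1) := by
  rw [hermite_succ, derivative_hermite]

theorem factorial_two_mul_div (l : ℕ) :
    ((2 * l).factorial : ℝ) / (2 ^ l * (l.factorial : ℝ)) =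
      (Nat.doubleFactorial (2 * l - 1) : ℝ) := by
  rcases l with _ | l
  · simp
  · have h : (2 * (l + 1)).factorial
        = 2 ^ (l + 1) * (l + 1).factorial * Nat.doubleFactorial (2 * (l + 1) - 1) := by
      rw [← Nat.doubleFactorial_two_mul]
      exact Nat.factorial_eq_mul_doubleFactorial (2 * l + 1)
    rw [h]
    push_cast
    have := Nat.factorial_pos (l + 1)
    field_simp

open Polynomial in
theorem He_eq_aeval_hermite (j : ℕ) (t : ℝ) : He j t = aeval t (hermite j) := by
  rw [aeval_eq_sum_range, natDegree_hermite, He]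
  refine Finset.sum_bij_ne_zero (fun l _ _ => j - 2 * l) ?_ ?_ ?_ ?_
  · intro l _ _
    simp only [Finset.mem_range]
    omega
  · intro a ha _ b hb _ hab
    simp only [Finset.mem_range] at ha hb hab
    omega
  · intro k hk hne
    simp only [Finset.mem_range] at hk
    have hc : coeff (hermite j) k ≠ 0 := by
      rintro h
      simp [h] at hne
    have hev : Even (j + k) := by
      by_contra h
      exact hc (coeff_hermite_of_odd_add (Nat.not_even_iff_odd.mp h))
    obtain ⟨r, hr⟩ := hev
    refine ⟨(j - k) / 2, by simp only [Finset.mem_range]; omega, ?_, by omega⟩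
    have hk' : j - 2 * ((j - k) / 2) = k := by omega
    rw [hk']
    have ht : t ^ k ≠ 0 := by
      intro h
      simp [h] at hne
    have hch : (j.choose (2 * ((j - k) / 2)) : ℝ) ≠ 0 :=
      Nat.cast_ne_zero.mpr (Nat.choose_pos (by omega)).ne'
    positivity
  · intro l hl _
    simp only [Finset.mem_range] at hl
    obtain ⟨k, rfl⟩ : ∃ k, j = 2 * l + k := ⟨j - 2 * l, by omega⟩
    rw [Nat.add_sub_cancel_left, coeff_hermite_explicit, factorial_two_mul_div,
      Nat.choose_symm_add]
    simp

open Polynomial in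
theorem integrable_eval_mul_gaussian {b : ℝ} (hb : 0 < b) (m : ℝ) (p : ℝ[X]) :
    Integrable fun t : ℝ => p.eval t * exp (-b * (t - m) ^ 2) := by
  have centered (q : ℝ[X]) : Integrable fun t : ℝ => q.eval t * exp (-b * t ^ 2) := by
    induction q using Polynomial.induction_on' with
    | add p q hp hq => simpa only [eval_add, add_mul] using! hp.add hq
    | monomial n a =>
      have h := (integrable_rpow_mul_exp_neg_mul_sq hb
        (s := n) (by linarith [n.cast_nonneg (α := ℝ)])).const_mul a
      simpa [rpow_natCast, mul_assoc] using h
  have h := (centered (p.comp (X + C m))).comp_sub_right m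
  have e (t : ℝ) : (p.comp (X + C m)).eval (t - m) = p.eval t := by
    rw [eval_comp, eval_add]
    simp
  simpa only [e] using h

open Polynomial in
theorem integrable_sub_mul_eval_mul_gaussian {b : ℝ} (hb : 0 < b) (m : ℝ) (p : ℝ[X]) :
    Integrable fun t : ℝ => (t - m) * p.eval t * exp (-b * (t - m) ^ 2) := by
  refine (integrable_eval_mul_gaussian hb m ((X - C m) * p)).congr (.of_forall fun t => ?_)
  dsimp only
  rw [eval_mul, eval_sub, eval_X, eval_C]

open Polynomial in
/-- Gaussian integration by parts against a polynomial. -/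
theorem integral_sub_mul_eval_mul_gaussian {b : ℝ} (hb : 0 < b) (m : ℝ) (p : ℝ[X]) :
    ∫ t : ℝ, (t - m) * p.eval t * exp (-b * (t - m) ^ 2) =
      (2 * b)⁻¹ * ∫ t : ℝ, p.derivative.eval t * exp (-b * (t - m) ^ 2) := by
  have hp' := integrable_eval_mul_gaussian hb m p.derivative
  have hm := integrable_sub_mul_eval_mul_gaussian hb m p
  have hderiv (t : ℝ) : HasDerivAt (fun t => p.eval t * exp (-b * (t - m) ^ 2))
      (p.derivative.eval t * exp (-b * (t - m) ^ 2)
        - 2 * b * ((t - m) * p.eval t * exp (-b * (t - m) ^ 2))) t := by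
    have he : HasDerivAt (fun t => -b * (t - m) ^ 2) (-b * (2 * (t - m))) t := by
      simpa using (((hasDerivAt_id t).sub_const m).pow 2).const_mul (-b)
    exact ((p.hasDerivAt t).mul he.exp).congr_deriv (by ring)
  have h := integral_eq_zero_of_hasDerivAt_of_integrable hderiv
    (hp'.sub (hm.const_mul (2 * b))) (integrable_eval_mul_gaussian hb m p)
  rw [integral_sub hp' (hm.const_mul (2 * b)), integral_const_mul] at h
  rw [sub_eq_zero.mp h]
  rw [inv_mul_cancel_left₀ (by positivity)]

open Polynomial in
/-- Integral of a rescaled Hermite polynomial against a Gaussian weight centred at `m`. -/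
theorem integral_hermite_mul_gaussian {b : ℝ} (hb : 0 < b) (m s : ℝ) {c : ℝ} (hc : c ≠ 0)
    (hcs : c ^ 2 = 1 - s ^ 2 / (2 * b)) (j : ℕ) :
    ∫ t : ℝ, aeval (s * t) (hermite j) * exp (-b * (t - m) ^ 2) =
      √(π / b) * (c ^ j * aeval (s * m / c) (hermite j)) := by
  induction j using Nat.strong_induction_on with
  | _ j ih =>
  rcases j with _ | j
  · have h := integral_sub_right_eq_self (fun t : ℝ => exp (-b * t ^ 2)) (μ := volume) m
    simpa [← integral_gaussian] using h
  let H (n : ℕ) : ℝ[X] := ((hermite n).map (Int.castRingHom ℝ)).comp (C s * X)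
  have hH (n : ℕ) (t : ℝ) : (H n).eval t = aeval (s * t) (hermite n) := by
    simp [H, aeval_def, eval_map]
  have hH' (t : ℝ) : (H j).derivative.eval t = s * j * aeval (s * t) (hermite (j - 1)) := by
    simp [H, derivative_comp, derivative_map, derivative_hermite, aeval_def, eval_map]
    ring
  have hint (n : ℕ) := integrable_eval_mul_gaussian hb m (H n)
  have hm := integrable_sub_mul_eval_mul_gaussian hb m (H j)
  have hparts := integral_sub_mul_eval_mul_gaussian hb m (H j)
  simp only [hH, hH'] at hint hm hparts
  have hsplit : ∫ t : ℝ, aeval (s * t) (hermite (j + 1)) * exp (-b * (t - m) ^ 2) =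
      s * m * (∫ t : ℝ, aeval (s * t) (hermite j) * exp (-b * (t - m) ^ 2))
      + s * (∫ t : ℝ, (t - m) * aeval (s * t) (hermite j) * exp (-b * (t - m) ^ 2))
      - j * ∫ t : ℝ, aeval (s * t) (hermite (j - 1)) * exp (-b * (t - m) ^ 2) := by
    rw [← integral_const_mul, ← integral_const_mul, ← integral_const_mul,
      ← integral_add ((hint j).const_mul _) (hm.const_mul _)]
    refine Eq.trans (integral_congr_ae (.of_forall fun t => ?_))
      (integral_sub (((hint j).const_mul _).add (hm.const_mul _)) ((hint (j - 1)).const_mul _))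
    simp only [hermite_succ_eq, map_sub, map_mul, aeval_X, map_natCast]
    ring
  simp only [mul_assoc (s * (j : ℝ))] at hparts
  rw [integral_const_mul] at hparts
  rw [hsplit, hparts, ih j (by omega), ih (j - 1) (by omega)]
  rcases j with _ | j
  · simp
    field_simp
  · simp only [hermite_succ_eq (j + 1), map_sub, map_mul, aeval_X, map_natCast,
      Nat.add_sub_cancel]
    have hs : s ^ 2 = (1 - c ^ 2) * (2 * b) := by
      rw [hcs]; field_simp; ring
    field_simp
    linear_combination
      c * c ^ j * ((j + 1 : ℕ) : ℝ) * aeval (s * m / c) (hermite j) * hs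

/-- Gaussian–Hermite integral identity: the `j`-th weighted Hermite coefficient of
the shifted Gaussian kernel `t ↦ φ(t−x)` equals `η_j χ_j(x) φ_{1+σ²}(x)`. -/
theorem hermite_coefficient_of_shifted_gaussian (σ : ℝ) (hσ : 0 < σ) (j : ℕ) (x : ℝ) :
    (∫ t, ψ σ j t * gauss 1 (t - x) * gauss (σ ^ 2) t) =
      η σ j * χ σ j x * gauss (1 + σ ^ 2) x := by
  have hσ' : 0 < 1 + σ ^ 2 := by positivity
  set R := √(1 + σ ^ 2) with hR
  have hRpos : 0 < R := Real.sqrt_pos.mpr hσ'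
  have hR2 : R ^ 2 = 1 + σ ^ 2 := Real.sq_sqrt hσ'.le
  have hη : √(σ ^ 2 / (1 + σ ^ 2)) = σ / R := by
    rw [Real.sqrt_div (sq_nonneg σ), Real.sqrt_sq hσ.le]
  set b := (1 + σ ^ 2) / (2 * σ ^ 2) with hb_def
  have hb : 0 < b := by positivity
  set m := x * σ ^ 2 / (1 + σ ^ 2) with hm_def
  have hexp (t : ℝ) : exp (-(t - x) ^ 2 / (2 * 1)) * exp (-t ^ 2 / (2 * σ ^ 2)) =
      exp (-x ^ 2 / (2 * (1 + σ ^ 2))) * exp (-b * (t - m) ^ 2) := by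
    rw [← exp_add, ← exp_add, hb_def, hm_def]
    congr 1
    field_simp
    ring
  have hconst : (√(2 * π * 1))⁻¹ * (√(2 * π * σ ^ 2))⁻¹ * √(π / b) =
      (√(2 * π * (1 + σ ^ 2)))⁻¹ := by
    rw [← Real.sqrt_inv, ← Real.sqrt_inv, ← Real.sqrt_inv, ← Real.sqrt_mul (by positivity),
      ← Real.sqrt_mul (by positivity), hb_def]
    congr 1
    field_simp
  have hfun (t : ℝ) : ψ σ j t * gauss 1 (t - x) * gauss (σ ^ 2) t =
      ((√(2 * π * 1))⁻¹ * (√(2 * π * σ ^ 2))⁻¹ * exp (-x ^ 2 / (2 * (1 + σ ^ 2)))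
        / √(j.factorial)) *
      (Polynomial.aeval (σ⁻¹ * t) (Polynomial.hermite j) * exp (-b * (t - m) ^ 2)) := by
    rw [ψ, gauss, gauss, He_eq_aeval_hermite, div_eq_inv_mul t σ]
    linear_combination (Polynomial.aeval (σ⁻¹ * t) (Polynomial.hermite j) / √(j.factorial)
      * (√(2 * π * 1))⁻¹ * (√(2 * π * σ ^ 2))⁻¹) * hexp t
  have harg : σ⁻¹ * m / (σ / R) = x / R := by
    rw [hm_def, ← hR2]
    field_simp
  have hcs : (σ / R) ^ 2 = 1 - σ⁻¹ ^ 2 / (2 * b) := by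
    rw [div_pow, hR2, hb_def]
    field_simp
    ring
  simp only [hfun]
  rw [integral_const_mul, integral_hermite_mul_gaussian hb m σ⁻¹ (by positivity) hcs, harg,
    η, χ, gauss, hη, He_eq_aeval_hermite, ← hconst]
  ring
end

section
/- For all x, y ∈ ℝ, the Parseval identity Σ_{j=0}^∞ η_j² ( χ_j(x) φ_{1+σ²}(x) − χ_j(y) φ_{1+σ²}(y) )² = ∫_ℝ (φ(t−x) − φ(t−y))² φ_{σ²}(t) dt holds; in particular, for every x ∈ ℝ, Σ_{j=0}^∞ η_j² χ_j(x)² φ_{1+σ²}(x)² = ∫_ℝ φ(t−x)² φ_{σ²}(t) dt. -/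
open MeasureTheory Real

open ProbabilityTheory

lemma cpow_half_pi_div_neg {b : ℝ} (hb : b < 0) :
    ((π : ℂ) / -(b : ℂ)) ^ (1 / 2 : ℂ) = (√(π / -b) : ℝ) := by
  rw [Real.sqrt_eq_rpow, Complex.ofReal_cpow (div_nonneg pi_pos.le (by linarith))]
  push_cast
  rfl

lemma integral_exp_quadratic {b : ℝ} (hb : b < 0) (c d : ℝ) :
    ∫ t : ℝ, rexp (b * t ^ 2 + c * t + d) = √(π / -b) * rexp (d - c ^ 2 / (4 * b)) := by
  have h := integral_cexp_quadratic (b := b) (by simpa using hb) c d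
  rw [cpow_half_pi_div_neg hb] at h
  exact_mod_cast h

lemma integrable_exp_quadratic {b : ℝ} (hb : b < 0) (c d : ℝ) :
    Integrable fun t : ℝ ↦ rexp (b * t ^ 2 + c * t + d) := by
  refine .of_integral_ne_zero ?_
  rw [integral_exp_quadratic hb]
  have : 0 < √(π / -b) := Real.sqrt_pos.2 (div_pos pi_pos (by linarith))
  positivity

/-- Gaussian expectation of the exponential of a quadratic polynomial. -/
lemma integral_cexp_quadratic_gaussianReal {b : ℝ} (hb : b < 1 / 2) (c d : ℂ) :
    ∫ z : ℝ, Complex.exp (b * z ^ 2 + c * z + d) ∂(gaussianReal 0 1) =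
      ((√(1 - 2 * b))⁻¹ : ℝ) * Complex.exp (d + c ^ 2 / (2 * (1 - 2 * b))) := by
  have h0 : 0 < 1 - 2 * b := by linarith
  rw [integral_gaussianReal_eq_integral_smul one_ne_zero]
  have h (z : ℝ) : gaussianPDFReal 0 1 z • Complex.exp (b * z ^ 2 + c * z + d) =
      ((√(2 * π))⁻¹ : ℝ) * Complex.exp (((b - 1 / 2 : ℝ) : ℂ) * z ^ 2 + c * z + d) := by
    rw [gaussianPDFReal, Complex.real_smul]
    push_cast
    rw [mul_assoc, ← Complex.exp_add]
    simp only [mul_one]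
    congr 2
    ring
  simp_rw [h]
  rw [integral_const_mul, integral_cexp_quadratic (by simp; linarith)]
  rw [cpow_half_pi_div_neg (by linarith), ← mul_assoc, ← Complex.ofReal_mul]
  congr 2
  · rw [← Real.sqrt_inv, ← Real.sqrt_mul (by positivity), ← Real.sqrt_inv]
    congr 1
    rw [neg_sub]
    have : 1 / 2 - b ≠ 0 := by linarith
    field_simp
  · rw [sub_eq_add_neg, ← div_neg]
    congr 2
    push_cast
    ring

lemma integrable_exp_mul_sq_gaussianReal {b : ℝ} (hb : b < 1 / 2) :
    Integrable (fun z : ℝ ↦ rexp (b * z ^ 2)) (gaussianReal 0 1) := by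
  have h : Integrable (fun z : ℝ ↦ Complex.exp (b * z ^ 2 + 0 * z + 0)) (gaussianReal 0 1) := by
    refine .of_integral_ne_zero ?_
    rw [integral_cexp_quadratic_gaussianReal hb]
    have : 0 < 1 - 2 * b := by linarith
    simp [(Real.sqrt_pos.2 this).ne']
  simpa [← Complex.ofReal_pow, ← Complex.ofReal_mul, Complex.norm_exp_ofReal] using h.norm

lemma integrable_pow_gaussianReal (n : ℕ) :
    Integrable (fun z : ℝ ↦ z ^ n) (gaussianReal 0 1) := by
  have := (memLp_id_gaussianReal (μ := 0) (v := 1) n).integrable_norm_pow'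
  refine this.mono' (by fun_prop) (.of_forall fun z ↦ ?_)
  simp

lemma integral_pow_add_two_gaussianReal (n : ℕ) :
    ∫ z, z ^ (n + 2) ∂(gaussianReal 0 1) = (n + 1) * ∫ z, z ^ n ∂(gaussianReal 0 1) := by
  have hint (k : ℕ) : Integrable fun z : ℝ ↦ z ^ k * rexp (-(1 / 2) * z ^ 2) := by
    have := integrable_rpow_mul_exp_neg_mul_sq (b := 1 / 2) (by norm_num) (s := k)
      (by linarith [k.cast_nonneg (α := ℝ)])
    simpa using this
  have hpdf (k : ℕ) : ∫ z, z ^ k ∂(gaussianReal 0 1) =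
      (√(2 * π))⁻¹ * ∫ z : ℝ, z ^ k * rexp (-(1 / 2) * z ^ 2) := by
    rw [integral_gaussianReal_eq_integral_smul one_ne_zero, ← integral_const_mul]
    congr with z
    simp [gaussianPDFReal]
    ring_nf
  have key := integral_eq_zero_of_hasDerivAt_of_integrable
    (f := fun z : ℝ ↦ z ^ (n + 1) * rexp (-(1 / 2) * z ^ 2))
    (f' := fun z ↦ (n + 1) * (z ^ n * rexp (-(1 / 2) * z ^ 2)) -
      z ^ (n + 2) * rexp (-(1 / 2) * z ^ 2))
    (fun z ↦ by
      have := (hasDerivAt_pow (n + 1) z).mul (((hasDerivAt_pow 2 z).const_mul (-(1 / 2))).exp)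
      convert! this using 1
      push_cast
      ring)
    (((hint n).const_mul _).sub (hint (n + 2))) (hint (n + 1))
  rw [integral_sub ((hint n).const_mul _) (hint (n + 2)), integral_const_mul] at key
  rw [hpdf, hpdf]
  linear_combination -(√(2 * π))⁻¹ * key

lemma integral_pow_odd_gaussianReal (l : ℕ) :
    ∫ z, z ^ (2 * l + 1) ∂(gaussianReal 0 1) = 0 := by
  induction l with
  | zero => simp [integral_id_gaussianReal]
  | succ l ih =>
    rw [show 2 * (l + 1) + 1 = (2 * l + 1) + 2 by ring, integral_pow_add_two_gaussianReal, ih,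
      mul_zero]

lemma integral_pow_even_gaussianReal (l : ℕ) :
    ∫ z, z ^ (2 * l) ∂(gaussianReal 0 1) =
      (Nat.factorial (2 * l) : ℝ) / ((2 : ℝ) ^ l * (Nat.factorial l : ℝ)) := by
  induction l with
  | zero => simp
  | succ l ih =>
    rw [show 2 * (l + 1) = 2 * l + 2 by ring, integral_pow_add_two_gaussianReal, ih]
    simp only [Nat.factorial_succ, pow_succ]
    push_cast
    field_simp
    ring

lemma sum_range_eq_sum_even {M : Type*} [AddCommMonoid M] (n : ℕ) (f : ℕ → M)
    (hf : ∀ l, f (2 * l + 1) = 0) :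
    ∑ k ∈ Finset.range (n + 1), f k = ∑ l ∈ Finset.range (n / 2 + 1), f (2 * l) := by
  have hinj : Set.InjOn (fun l ↦ 2 * l) (Finset.range (n / 2 + 1) : Set ℕ) :=
    fun a _ b _ h ↦ by simpa using h
  rw [← Finset.sum_image (f := f) hinj]
  symm
  refine Finset.sum_subset (fun k hk ↦ ?_) fun k hk hk' ↦ ?_
  · simp at hk ⊢
    omega
  · obtain ⟨l, rfl | rfl⟩ := k.even_or_odd'
    · simp at hk hk'
      omega
    · exact hf l

/-- Hermite polynomials as Gaussian moments along a vertical line. -/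
lemma ofReal_He_eq_integral (n : ℕ) (a : ℝ) :
    (He n a : ℂ) = ∫ z : ℝ, ((a : ℂ) + z * Complex.I) ^ n ∂(gaussianReal 0 1) := by
  have h (z : ℝ) : ((a : ℂ) + z * Complex.I) ^ n = ∑ k ∈ Finset.range (n + 1),
      ((z ^ k : ℝ) : ℂ) * (Complex.I ^ k * a ^ (n - k) * n.choose k) := by
    rw [add_comm, add_pow]
    refine Finset.sum_congr rfl fun k _ ↦ ?_
    push_cast
    ring
  simp_rw [h]
  rw [integral_finsetSum _ fun k _ ↦ ((integrable_pow_gaussianReal k).ofReal.mul_const _)]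
  simp_rw [integral_mul_const, integral_complex_ofReal]
  rw [sum_range_eq_sum_even _ _ fun l ↦ by rw [integral_pow_odd_gaussianReal]; simp, He]
  push_cast
  refine Finset.sum_congr rfl fun l _ ↦ ?_
  rw [integral_pow_even_gaussianReal, pow_mul, Complex.I_sq]
  push_cast
  ring

lemma norm_mul_add_mul_I_le {r : ℝ} (hr : 0 ≤ r) (a b z w : ℝ) :
    ‖(r : ℂ) * ((a + z * Complex.I) * (b + w * Complex.I))‖ ≤
      r / 2 * (a ^ 2 + b ^ 2) + (r / 2 * z ^ 2 + r / 2 * w ^ 2) := by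
  have h (u v : ℝ) : ‖(u : ℂ) + v * Complex.I‖ ^ 2 = u ^ 2 + v ^ 2 := by
    rw [Complex.sq_norm, Complex.normSq_add_mul_I]
  rw [norm_mul, norm_mul, Complex.norm_real, Real.norm_of_nonneg hr]
  nlinarith [two_mul_le_add_sq ‖(a : ℂ) + z * Complex.I‖ ‖(b : ℂ) + w * Complex.I‖, h a z, h b w]

lemma integrable_exp_norm_mul_add_mul_I {r : ℝ} (hr0 : 0 ≤ r) (hr : r < 1) (a b : ℝ) :
    Integrable (fun p : ℝ × ℝ ↦
      rexp ‖(r : ℂ) * ((a + p.1 * Complex.I) * (b + p.2 * Complex.I))‖)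
      ((gaussianReal 0 1).prod (gaussianReal 0 1)) := by
  have h := integrable_exp_mul_sq_gaussianReal (b := r / 2) (by linarith)
  refine ((h.mul_prod h).const_mul (rexp (r / 2 * (a ^ 2 + b ^ 2)))).mono' (by fun_prop)
    (.of_forall fun p ↦ ?_)
  rw [Real.norm_of_nonneg (Real.exp_pos _).le, ← Real.exp_add, ← Real.exp_add]
  exact Real.exp_le_exp.2 (norm_mul_add_mul_I_le hr0 a b p.1 p.2)

lemma integral_cexp_mul_add_mul_I {r : ℝ} (hr0 : 0 ≤ r) (hr : r < 1) (a b : ℝ) :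
    ∫ p : ℝ × ℝ, Complex.exp (r * ((a + p.1 * Complex.I) * (b + p.2 * Complex.I)))
      ∂((gaussianReal 0 1).prod (gaussianReal 0 1)) =
      ((√(1 - r ^ 2))⁻¹ *
        rexp ((2 * r * a * b - r ^ 2 * (a ^ 2 + b ^ 2)) / (2 * (1 - r ^ 2))) : ℝ) := by
  have hr2 : 0 < 1 - r ^ 2 := by nlinarith
  have hc : (1 : ℂ) - r ^ 2 ≠ 0 := by exact_mod_cast hr2.ne'
  rw [integral_prod]
  swap
  · refine (integrable_exp_norm_mul_add_mul_I hr0 hr a b).mono' (by fun_prop)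
      (.of_forall fun p ↦ ?_)
    rw [Complex.norm_exp]
    exact Real.exp_le_exp.2 (Complex.re_le_norm _)
  have inner (z : ℝ) :
      ∫ w : ℝ, Complex.exp (r * ((a + z * Complex.I) * (b + w * Complex.I)))
        ∂(gaussianReal 0 1) =
      Complex.exp ((r ^ 2 / 2 : ℝ) * z ^ 2 + (r * b - r ^ 2 * a) * Complex.I * z +
        (r * a * b - r ^ 2 * a ^ 2 / 2)) := by
    have h := integral_cexp_quadratic_gaussianReal (b := 0) (by norm_num)
      (r * (a + z * Complex.I) * Complex.I) (r * (a + z * Complex.I) * b)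
    convert h using 1
    · congr with w
      congr 1
      push_cast
      ring
    · simp only [mul_zero, sub_zero, Real.sqrt_one, inv_one, Complex.ofReal_one, one_mul,
        Complex.ofReal_zero, mul_one]
      congr 1
      push_cast
      linear_combination (-(r ^ 2 * z ^ 2 * (Complex.I ^ 2 - 1) / 2) - r ^ 2 * a ^ 2 / 2
        - r ^ 2 * a * z * Complex.I : ℂ) * Complex.I_sq
  simp_rw [inner]
  rw [integral_cexp_quadratic_gaussianReal (by linarith)]
  push_cast
  rw [show 2 * (r ^ 2 / 2) = r ^ 2 by ring]
  congr 2
  rw [show (1 : ℂ) - 2 * (r ^ 2 / 2) = 1 - r ^ 2 by ring, mul_pow, Complex.I_sq]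
  field_simp
  ring

/-- Mehler's formula. -/
theorem hasSum_He_mul_He {r : ℝ} (hr0 : 0 ≤ r) (hr : r < 1) (a b : ℝ) :
    HasSum (fun n : ℕ ↦ r ^ n / (Nat.factorial n : ℝ) * (He n a * He n b))
      ((√(1 - r ^ 2))⁻¹ *
        rexp ((2 * r * a * b - r ^ 2 * (a ^ 2 + b ^ 2)) / (2 * (1 - r ^ 2)))) := by
  let P := (gaussianReal 0 1).prod (gaussianReal 0 1)
  let u : ℝ × ℝ → ℂ := fun p ↦ r * ((a + p.1 * Complex.I) * (b + p.2 * Complex.I))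
  have hu : Continuous u := by fun_prop
  have hexp (p : ℝ × ℝ) :
      HasSum (fun n : ℕ ↦ ‖u p‖ ^ n / (Nat.factorial n : ℝ)) (rexp ‖u p‖) := by
    rw [Real.exp_eq_exp_ℝ]
    exact NormedSpace.expSeries_div_hasSum_exp _
  have key : HasSum (fun n : ℕ ↦ ∫ p, u p ^ n / (Nat.factorial n : ℂ) ∂P)
      (∫ p, Complex.exp (u p) ∂P) := by
    refine hasSum_integral_of_dominated_convergence
      (fun n p ↦ ‖u p‖ ^ n / (Nat.factorial n : ℝ))
      (fun n ↦ by fun_prop) (fun n ↦ .of_forall fun p ↦ by simp)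
      (.of_forall fun p ↦ (hexp p).summable) ?_ (.of_forall fun p ↦ ?_)
    · simp_rw [fun p ↦ (hexp p).tsum_eq]
      exact integrable_exp_norm_mul_add_mul_I hr0 hr a b
    · rw [Complex.exp_eq_exp_ℂ]
      exact NormedSpace.expSeries_div_hasSum_exp _
  rw [integral_cexp_mul_add_mul_I hr0 hr] at key
  rw [← Complex.hasSum_ofReal]
  convert key using 2 with n
  push_cast
  rw [ofReal_He_eq_integral, ofReal_He_eq_integral, ← integral_prod_mul, ← integral_const_mul]
  congr with p
  simp only [u, mul_pow]
  ring

lemma gauss_mul_gauss_mul_gauss {σ : ℝ} (hσ : 0 < σ) (x y t : ℝ) :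
    gauss 1 (t - x) * gauss 1 (t - y) * gauss (σ ^ 2) t =
      (2 * π)⁻¹ * (√(2 * π * σ ^ 2))⁻¹ *
        rexp (-((2 * σ ^ 2 + 1) / (2 * σ ^ 2)) * t ^ 2 + (x + y) * t +
          -((x ^ 2 + y ^ 2) / 2)) := by
  have h : (√(2 * π * 1))⁻¹ * (√(2 * π * 1))⁻¹ = (2 * π)⁻¹ := by
    rw [← mul_inv, mul_one, Real.mul_self_sqrt (by positivity)]
  simp only [gauss]
  rw [← h, show -((2 * σ ^ 2 + 1) / (2 * σ ^ 2)) * t ^ 2 + (x + y) * t +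
      -((x ^ 2 + y ^ 2) / 2) =
      -(t - x) ^ 2 / (2 * 1) + -(t - y) ^ 2 / (2 * 1) + -t ^ 2 / (2 * σ ^ 2) by
    field_simp
    ring, Real.exp_add, Real.exp_add]
  ring

lemma integrable_gauss_mul_gauss_mul_gauss {σ : ℝ} (hσ : 0 < σ) (x y : ℝ) :
    Integrable fun t ↦ gauss 1 (t - x) * gauss 1 (t - y) * gauss (σ ^ 2) t := by
  simp_rw [gauss_mul_gauss_mul_gauss hσ]
  exact (integrable_exp_quadratic (neg_neg_of_pos (by positivity)) _ _).const_mul _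

lemma integral_gauss_mul_gauss_mul_gauss {σ : ℝ} (hσ : 0 < σ) (x y : ℝ) :
    ∫ t, gauss 1 (t - x) * gauss 1 (t - y) * gauss (σ ^ 2) t =
      (2 * π)⁻¹ * (√(2 * σ ^ 2 + 1))⁻¹ *
        rexp (-((x ^ 2 + y ^ 2) / 2) + (x + y) ^ 2 * σ ^ 2 / (2 * (2 * σ ^ 2 + 1))) := by
  simp_rw [gauss_mul_gauss_mul_gauss hσ]
  rw [integral_const_mul, integral_exp_quadratic (neg_neg_of_pos (by positivity)), ← mul_assoc,
    mul_assoc (2 * π)⁻¹]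
  congr 2
  · rw [← Real.sqrt_inv, ← Real.sqrt_inv, ← Real.sqrt_mul (by positivity)]
    congr 1
    field_simp
  · field_simp
    ring

lemma eta_sq (σ : ℝ) (j : ℕ) : η σ j ^ 2 = (σ ^ 2 / (1 + σ ^ 2)) ^ j := by
  rw [η, ← pow_mul, mul_comm, pow_mul, Real.sq_sqrt (by positivity)]

/-- Mehler's formula as an expansion of a Gaussian reproducing kernel. -/
lemma hasSum_chi_mul_chi {σ : ℝ} (hσ : 0 < σ) (x y : ℝ) :
    HasSum (fun j : ℕ ↦ η σ j ^ 2 *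
        ((χ σ j x * gauss (1 + σ ^ 2) x) * (χ σ j y * gauss (1 + σ ^ 2) y)))
      (∫ t, gauss 1 (t - x) * gauss 1 (t - y) * gauss (σ ^ 2) t) := by
  have hs : 0 < 1 + σ ^ 2 := by positivity
  have hs' : √(1 + σ ^ 2) ^ 2 = 1 + σ ^ 2 := Real.sq_sqrt hs.le
  have h := (hasSum_He_mul_He (r := σ ^ 2 / (1 + σ ^ 2)) (by positivity)
    (by rw [div_lt_one hs]; linarith) (x / √(1 + σ ^ 2)) (y / √(1 + σ ^ 2))).mul_right
      (gauss (1 + σ ^ 2) x * gauss (1 + σ ^ 2) y)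
  convert! h using 1
  · ext j
    have hj : (√(Nat.factorial j : ℝ))⁻¹ ^ 2 = (Nat.factorial j : ℝ)⁻¹ := by
      rw [inv_pow, Real.sq_sqrt (Nat.cast_nonneg _)]
    rw [eta_sq, χ, χ, div_eq_mul_inv _ (Nat.factorial j : ℝ), ← hj]
    ring
  · have h1 : 1 - (σ ^ 2 / (1 + σ ^ 2)) ^ 2 = (2 * σ ^ 2 + 1) / (1 + σ ^ 2) ^ 2 := by
      field_simp
      ring
    have h2 : (√(2 * π * (1 + σ ^ 2)))⁻¹ * (√(2 * π * (1 + σ ^ 2)))⁻¹ =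
        (2 * π)⁻¹ * (1 + σ ^ 2)⁻¹ := by
      rw [← mul_inv, Real.mul_self_sqrt (by positivity), mul_inv]
    have h3 : (2 * (σ ^ 2 / (1 + σ ^ 2)) * (x / √(1 + σ ^ 2)) * (y / √(1 + σ ^ 2)) -
        (σ ^ 2 / (1 + σ ^ 2)) ^ 2 * ((x / √(1 + σ ^ 2)) ^ 2 + (y / √(1 + σ ^ 2)) ^ 2)) =
        (2 * σ ^ 2 * (x * y) * (1 + σ ^ 2) - σ ^ 4 * (x ^ 2 + y ^ 2)) / (1 + σ ^ 2) ^ 3 := by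
      rw [div_pow x, div_pow y, mul_assoc, div_mul_div_comm x, ← sq, hs']
      field_simp
    have h4 : -((x ^ 2 + y ^ 2) / 2) + (x + y) ^ 2 * σ ^ 2 / (2 * (2 * σ ^ 2 + 1)) =
        (2 * σ ^ 2 * (x * y) * (1 + σ ^ 2) - σ ^ 4 * (x ^ 2 + y ^ 2)) / (1 + σ ^ 2) ^ 3 /
          (2 * ((2 * σ ^ 2 + 1) / (1 + σ ^ 2) ^ 2)) +
          (-x ^ 2 / (2 * (1 + σ ^ 2)) + -y ^ 2 / (2 * (1 + σ ^ 2))) := by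
      field_simp
      ring
    rw [integral_gauss_mul_gauss_mul_gauss hσ, h3, h1, h4, Real.exp_add, Real.exp_add,
      Real.sqrt_div (by positivity), Real.sqrt_sq hs.le, gauss, gauss, inv_div]
    set E := rexp ((2 * σ ^ 2 * (x * y) * (1 + σ ^ 2) - σ ^ 4 * (x ^ 2 + y ^ 2)) /
      (1 + σ ^ 2) ^ 3 / (2 * ((2 * σ ^ 2 + 1) / (1 + σ ^ 2) ^ 2)))
    set F := (√(2 * σ ^ 2 + 1))⁻¹ * E * rexp (-x ^ 2 / (2 * (1 + σ ^ 2))) *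
      rexp (-y ^ 2 / (2 * (1 + σ ^ 2)))
    linear_combination (-(1 + σ ^ 2) * F) * h2 - (2 * π)⁻¹ * F * mul_inv_cancel₀ hs.ne'

/-- Parseval identity for coefficient sequences of shifted Gaussian kernels. -/
theorem parseval_shifted_gaussians (σ : ℝ) (hσ : 0 < σ) (x y : ℝ) :
    Summable (fun j : ℕ => η σ j ^ 2 *
      (χ σ j x * gauss (1 + σ ^ 2) x - χ σ j y * gauss (1 + σ ^ 2) y) ^ 2) ∧
    (∑' j : ℕ, η σ j ^ 2 *
        (χ σ j x * gauss (1 + σ ^ 2) x - χ σ j y * gauss (1 + σ ^ 2) y) ^ 2) =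
      (∫ t, (gauss 1 (t - x) - gauss 1 (t - y)) ^ 2 * gauss (σ ^ 2) t) ∧
    (∑' j : ℕ, η σ j ^ 2 * (χ σ j x * gauss (1 + σ ^ 2) x) ^ 2) =
      (∫ t, gauss 1 (t - x) ^ 2 * gauss (σ ^ 2) t) := by
  have hxx := hasSum_chi_mul_chi hσ x x
  have hxy := hasSum_chi_mul_chi hσ x y
  have hyy := hasSum_chi_mul_chi hσ y y
  have ixx := integrable_gauss_mul_gauss_mul_gauss hσ x x
  have ixy := integrable_gauss_mul_gauss_mul_gauss hσ x y
  have iyy := integrable_gauss_mul_gauss_mul_gauss hσ y y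
  have h : HasSum (fun j : ℕ => η σ j ^ 2 *
      (χ σ j x * gauss (1 + σ ^ 2) x - χ σ j y * gauss (1 + σ ^ 2) y) ^ 2)
      (∫ t, (gauss 1 (t - x) - gauss 1 (t - y)) ^ 2 * gauss (σ ^ 2) t) := by
    convert! (hxx.sub (hxy.mul_left 2)).add hyy using 1
    · ext j
      ring
    · rw [← integral_const_mul, ← integral_sub ixx (ixy.const_mul 2),
        ← integral_add (by exact ixx.sub (ixy.const_mul 2)) iyy]
      congr with t
      ring
  refine ⟨h.summable, h.tsum_eq, ?_⟩
  simp_rw [sq (χ σ _ x * _), sq (gauss 1 _)]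
  exact hxx.tsum_eq
end

section
/- For every t ∈ ℝ, the characteristic function of the absolute value of a standard normal random variable satisfies ∫_ℝ exp(i·t·|z|) φ(z) dz = exp(−t²/2) · ( 1 + i·√(2/π) · ∫₀^t exp(u²/2) du ). -/
open MeasureTheory Real

open Filter Set

theorem norm_cexp_I_mul_sub_sq (t z : ℝ) :
    ‖Complex.exp (Complex.I * t * z - (z : ℂ) ^ 2 / 2)‖ = Real.exp (-(1 / 2) * z ^ 2) := by
  rw [Complex.norm_exp]
  congr 1
  have h : Complex.I * t * z - (z : ℂ) ^ 2 / 2 =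
      ((-(1 / 2) * z ^ 2 : ℝ) : ℂ) + ((t * z : ℝ) : ℂ) * Complex.I := by
    push_cast; ring
  rw [h]
  simp only [Complex.add_re, Complex.ofReal_re, Complex.re_ofReal_mul, Complex.I_re, mul_zero,
    add_zero]

theorem integrable_cexp_I_mul_sub_sq (t : ℝ) :
    Integrable fun z : ℝ => Complex.exp (Complex.I * t * z - (z : ℂ) ^ 2 / 2) := by
  refine (integrable_exp_neg_mul_sq (b := 1 / 2) (by norm_num)).mono'
    (by fun_prop) (ae_of_all _ fun z => ?_)
  rw [norm_cexp_I_mul_sub_sq]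

theorem integrable_mul_cexp_I_mul_sub_sq (t : ℝ) :
    Integrable fun z : ℝ => (z : ℂ) * Complex.exp (Complex.I * t * z - (z : ℂ) ^ 2 / 2) := by
  refine (integrable_mul_exp_neg_mul_sq (b := 1 / 2) (by norm_num)).norm.mono'
    (by fun_prop) (ae_of_all _ fun z => ?_)
  rw [norm_mul, norm_cexp_I_mul_sub_sq, norm_mul, Complex.norm_real,
    Real.norm_of_nonneg (Real.exp_pos _).le]

theorem tendsto_cexp_I_mul_sub_sq (t : ℝ) :
    Tendsto (fun z : ℝ => Complex.exp (Complex.I * t * z - (z : ℂ) ^ 2 / 2)) atTop (nhds 0) := by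
  rw [tendsto_zero_iff_norm_tendsto_zero]
  simp_rw [norm_cexp_I_mul_sub_sq]
  exact Real.tendsto_exp_atBot.comp
    ((tendsto_pow_atTop two_ne_zero).const_mul_atTop_of_neg (by norm_num))

theorem integral_Ioi_mul_cexp_I_mul_sub_sq (t : ℝ) :
    ∫ z : ℝ in Ioi 0, (z : ℂ) * Complex.exp (Complex.I * t * z - (z : ℂ) ^ 2 / 2) =
      1 + Complex.I * t *
        ∫ z : ℝ in Ioi 0, Complex.exp (Complex.I * t * z - (z : ℂ) ^ 2 / 2) := by
  have hi := (integrable_cexp_I_mul_sub_sq t).const_mul (Complex.I * t)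
  have hm := integrable_mul_cexp_I_mul_sub_sq t
  have hd (z : ℝ) : HasDerivAt
      (fun z : ℝ => Complex.exp (Complex.I * t * z - (z : ℂ) ^ 2 / 2))
      (Complex.I * t * Complex.exp (Complex.I * t * z - (z : ℂ) ^ 2 / 2) -
        z * Complex.exp (Complex.I * t * z - (z : ℂ) ^ 2 / 2)) z := by
    have h1 : HasDerivAt (fun w : ℂ => Complex.I * t * w - w ^ 2 / 2) (Complex.I * t - z) z := by
      convert! ((hasDerivAt_id (z : ℂ)).const_mul (Complex.I * t)).sub
        ((hasDerivAt_pow 2 (z : ℂ)).div_const 2) using 1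
      simp
    convert! h1.cexp.comp_ofReal using 1
    ring
  have h := integral_Ioi_of_hasDerivAt_of_tendsto' (a := 0) (fun z _ => hd z)
    (hi.sub hm).integrableOn (tendsto_cexp_I_mul_sub_sq t)
  rw [integral_sub hi.integrableOn hm.integrableOn, integral_const_mul] at h
  simp only [Complex.ofReal_zero, mul_zero, ne_eq, OfNat.ofNat_ne_zero, not_false_eq_true,
    zero_pow, zero_div, sub_zero, Complex.exp_zero] at h
  linear_combination -h

theorem hasDerivAt_integral_Ioi_cexp_I_mul_sub_sq (t : ℝ) :
    HasDerivAt
      (fun t : ℝ => ∫ z : ℝ in Ioi 0, Complex.exp (Complex.I * t * z - (z : ℂ) ^ 2 / 2))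
      (Complex.I - t * ∫ z : ℝ in Ioi 0, Complex.exp (Complex.I * t * z - (z : ℂ) ^ 2 / 2)) t := by
  have h := (hasDerivAt_integral_of_dominated_loc_of_deriv_le (μ := volume.restrict (Ioi (0 : ℝ)))
    (F := fun (t z : ℝ) => Complex.exp (Complex.I * t * z - (z : ℂ) ^ 2 / 2))
    (F' := fun (t z : ℝ) => Complex.I *
      (z * Complex.exp (Complex.I * t * z - (z : ℂ) ^ 2 / 2)))
    (bound := fun z => ‖z * Real.exp (-(1 / 2) * z ^ 2)‖) (x₀ := t) univ_mem
    (Eventually.of_forall fun s => by fun_prop) (integrable_cexp_I_mul_sub_sq t).integrableOn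
    (by fun_prop) (ae_of_all _ fun z s _ => ?_)
    (integrable_mul_exp_neg_mul_sq (b := 1 / 2) (by norm_num)).norm.integrableOn
    (ae_of_all _ fun z s _ => ?_)).2
  · convert! h using 1
    rw [integral_const_mul, integral_Ioi_mul_cexp_I_mul_sub_sq]
    linear_combination -(t * ∫ z : ℝ in Ioi 0,
      Complex.exp (Complex.I * t * z - (z : ℂ) ^ 2 / 2)) * Complex.I_sq
  · rw [norm_mul, norm_mul, norm_cexp_I_mul_sub_sq, norm_mul, Complex.norm_real, Complex.norm_I,
      Real.norm_of_nonneg (Real.exp_pos _).le, one_mul]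
  · have h1 : HasDerivAt (fun w : ℂ => Complex.I * w * z - (z : ℂ) ^ 2 / 2) (Complex.I * z) s := by
      convert! (((hasDerivAt_id (s : ℂ)).const_mul Complex.I).mul_const (z : ℂ)).sub_const
        ((z : ℂ) ^ 2 / 2) using 1
      simp
    convert! h1.cexp.comp_ofReal using 1
    ring

theorem integral_Ioi_cexp_I_mul_sub_sq (t : ℝ) :
    ∫ z : ℝ in Ioi 0, Complex.exp (Complex.I * t * z - (z : ℂ) ^ 2 / 2) =
      Complex.exp (-(t : ℂ) ^ 2 / 2) * ((√(2 * π) / 2 : ℝ) +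
        Complex.I * ((∫ u in (0 : ℝ)..t, Real.exp (u ^ 2 / 2) : ℝ) : ℂ)) := by
  set G : ℝ → ℂ := fun t => ∫ z : ℝ in Ioi 0, Complex.exp (Complex.I * t * z - (z : ℂ) ^ 2 / 2)
    with hG
  have hd (s : ℝ) : HasDerivAt (fun s : ℝ => Complex.exp ((s : ℂ) ^ 2 / 2) * G s -
      Complex.I * ((∫ u in (0 : ℝ)..s, Real.exp (u ^ 2 / 2) : ℝ) : ℂ)) 0 s := by
    have h1 : HasDerivAt (fun s : ℝ => Complex.exp ((s : ℂ) ^ 2 / 2))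
        (Complex.exp ((s : ℂ) ^ 2 / 2) * s) s := by
      have h : HasDerivAt (fun w : ℂ => w ^ 2 / 2) (s : ℂ) (s : ℂ) := by
        convert! (hasDerivAt_pow 2 (s : ℂ)).div_const 2 using 1
        simp
      exact h.cexp.comp_ofReal
    have h2 : HasDerivAt (fun s : ℝ => ∫ u in (0 : ℝ)..s, Real.exp (u ^ 2 / 2))
        (Real.exp (s ^ 2 / 2)) s :=
      (by fun_prop : Continuous fun u : ℝ => Real.exp (u ^ 2 / 2)).integral_hasStrictDerivAt 0 s
        |>.hasDerivAt
    convert! (h1.mul (hasDerivAt_integral_Ioi_cexp_I_mul_sub_sq s)).sub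
      (h2.ofReal_comp.const_mul Complex.I) using 1
    push_cast
    ring
  have hG0 : G 0 = (√(2 * π) / 2 : ℝ) := by
    have h := integral_gaussian_Ioi (1 / 2)
    rw [show π / (1 / 2) = 2 * π by ring] at h
    rw [← h, ← integral_complex_ofReal, hG]
    refine integral_congr_ae (ae_of_all _ fun z => ?_)
    push_cast
    congr 1
    ring
  have hc := is_const_of_deriv_eq_zero (fun s => (hd s).differentiableAt) (fun s => (hd s).deriv)
    t 0
  simp only [hG0, Complex.ofReal_zero, intervalIntegral.integral_same, ne_eq, OfNat.ofNat_ne_zero,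
    not_false_eq_true, zero_pow, zero_div, Complex.exp_zero, mul_zero, sub_zero, one_mul] at hc
  rw [← hc, sub_add_cancel, ← mul_assoc, ← Complex.exp_add, neg_div, neg_add_cancel,
    Complex.exp_zero, one_mul]

theorem integral_comp_abs_of_integrableOn {E : Type*} [NormedAddCommGroup E] [NormedSpace ℝ E]
    {f : ℝ → E} (hf : IntegrableOn f (Ioi 0)) :
    ∫ z, f |z| = (2 : ℝ) • ∫ z in Ioi (0 : ℝ), f z := by
  have hpos : EqOn (fun z => f |z|) f (Ioi 0) := fun z hz => by simp [abs_of_pos (mem_Ioi.1 hz)]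
  have hneg : EqOn (fun z => f |z|) (fun z => f (-z)) (Iic 0) :=
    fun z hz => by simp [abs_of_nonpos (mem_Iic.1 hz)]
  have hfn : IntegrableOn (fun z => f (-z)) (Iic 0) := by
    rw [← neg_zero] at hf
    exact (integrableOn_Iic_iff_integrableOn_Iio (by simp)).2 hf.comp_neg_Iio
  rw [← setIntegral_univ, ← Iic_union_Ioi (a := (0 : ℝ)),
    setIntegral_union (Iic_disjoint_Ioi le_rfl) measurableSet_Ioi
      (hfn.congr_fun hneg.symm measurableSet_Iic) (hf.congr_fun hpos.symm measurableSet_Ioi),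
    setIntegral_congr_fun measurableSet_Iic hneg, setIntegral_congr_fun measurableSet_Ioi hpos,
    integral_comp_neg_Iic, neg_zero, two_smul]

open Complex in
/-- Characteristic function of the absolute value of a standard normal. -/
theorem charFun_abs_std_normal (t : ℝ) :
    (∫ z : ℝ, Complex.exp (Complex.I * t * |z|) * (gauss 1 z : ℂ)) =
      Complex.exp (-(t : ℂ) ^ 2 / 2) *
        (1 + Complex.I * (Real.sqrt (2 / Real.pi) : ℂ) *
          ((∫ u in (0 : ℝ)..t, Real.exp (u ^ 2 / 2) : ℝ) : ℂ)) := by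
  have hpt (z : ℝ) : Complex.exp (Complex.I * t * |z|) * (gauss 1 z : ℂ) =
      ((√(2 * π))⁻¹ : ℝ) *
        Complex.exp (Complex.I * t * (|z| : ℝ) - ((|z| : ℝ) : ℂ) ^ 2 / 2) := by
    rw [← Complex.ofReal_pow |z|, sq_abs, sub_eq_add_neg, Complex.exp_add, gauss]
    push_cast
    rw [mul_one, mul_one, neg_div]
    ring
  have hs : √(2 * π) ≠ 0 := by positivity
  have h1 : (√(2 * π))⁻¹ * 2 * (√(2 * π) / 2) = 1 := by field_simp
  have h2 : (√(2 * π))⁻¹ * 2 = √(2 / π) := by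
    rw [← Real.sqrt_inv, eq_comm, Real.sqrt_eq_iff_mul_self_eq (by positivity) (by positivity),
      mul_mul_mul_comm, Real.mul_self_sqrt (by positivity)]
    field_simp
  simp_rw [hpt]
  rw [integral_const_mul, integral_comp_abs_of_integrableOn
    (f := fun z : ℝ => Complex.exp (Complex.I * t * z - (z : ℂ) ^ 2 / 2))
    (integrable_cexp_I_mul_sub_sq t).integrableOn, integral_Ioi_cexp_I_mul_sub_sq, ← h2,
    ← Complex.ofReal_one, ← h1, Complex.real_smul]
  push_cast
  ring
end
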